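/- Let G be an amenable group and let X be an irreducible complete algebraic variety over an algebraically closed field K. Let A := X(K) denote the set of K-points of X. Then every pre-injective algebraic cellular automaton τ : A^G → A^G over (G,X,K) is surjective. -/

import Mathlib

open AlgebraicGeometry CategoryTheory CategoryTheory.Limits Filter Topology
open scoped ENNReal NNReal

noncomputable section

namespace GOE

/-! ## Følner nets and amenability -/

/-- A (right) Følner net for a group `G`: a net of nonempty finite subsets `F i ⊆ G`,
indexed by a directed nonempty preorder, such that `|F i \ F i g| / |F i| → 0` for every
`g ∈ G`. -/
structure FolnerNet (G : Type) [Group G] where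
  ι : Type
  [pre : Preorder ι]
  [ne : Nonempty ι]
  [dir : IsDirected ι (· ≤ ·)]
  F : ι → Finset G
  nonempty : ∀ i, (F i).Nonempty
  folner : ∀ g : G,
    Filter.Tendsto
      (fun i => ((((F i : Set G) \ ((· * g) '' (F i : Set G))).ncard : ℝ) / ((F i).card : ℝ)))
      Filter.atTop (nhds 0)

attribute [instance] FolnerNet.pre FolnerNet.ne FolnerNet.dir

/-- A group is amenable if it admits a Følner net. -/
def Amenable (G : Type) [Group G] : Prop := Nonempty (FolnerNet G)

/-! ## Constructible subsets of a topological space -/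

/-- A subset of a topological space is constructible if it is a finite union of
locally closed subsets. -/
def IsConstr {X : Type} [TopologicalSpace X] (C : Set X) : Prop :=
  ∃ (n : ℕ) (U Z : Fin n → Set X), (∀ i, IsOpen (U i)) ∧ (∀ i, IsClosed (Z i)) ∧
    C = ⋃ i, U i ∩ Z i

/-- Conversion of a Krull dimension (an element of `WithBot ℕ∞`) to an extended real. -/
def dimE (d : WithBot ℕ∞) : EReal :=
  WithBot.recBotCoe ⊥ (fun n : ℕ∞ => ((n : ℝ≥0∞) : EReal)) d

/-! ## Varieties over a field and their points -/

variable (K : Type) [Field K]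

/-- The spectrum of the field `K`, as a scheme. -/
abbrev SpecK : Scheme := Spec (CommRingCat.of K)

/-- The unique point of `Spec K`. -/
def specPt : SpecK K := (⟨⊥, Ideal.bot_prime⟩ : PrimeSpectrum K)

instance : HasFiniteProducts (Over (SpecK K)) :=
  CategoryTheory.Over.ConstructProducts.over_finiteProducts_of_finiteWidePullbacks

/-- The set of `K`-points of a `K`-scheme, i.e. sections of the structure morphism,
i.e. morphisms `Spec K ⟶ X` over `Spec K`. -/
abbrev Pt (W : Over (SpecK K)) : Type := Over.mk (𝟙 (SpecK K)) ⟶ W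

/-- The image in (the underlying space of) `W` of a `K`-point of `W`. -/
def ev {W : Over (SpecK K)} (a : Pt K W) : W.left := a.left.base (specPt K)

/-- The fibered power `X^Ω` over `Spec K` of a `K`-scheme `X`, for a finite index set `Ω`. -/
def pow (V : Over (SpecK K)) (Ω : Type) [Finite Ω] : Over (SpecK K) :=
  ∏ᶜ (fun _ : Ω => V)

/-- The canonical identification of families of `K`-points indexed by `Ω` with
`K`-points of the fibered power `X^Ω`. -/
def ptPow (V : Over (SpecK K)) (Ω : Type) [Finite Ω] (a : Ω → Pt K V) :
    Pt K (pow K V Ω) := Pi.lift a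

variable (V : Over (SpecK K))

/-- The Krull dimension of (the underlying space of) a `K`-scheme. -/
def vdim : WithBot ℕ∞ := topologicalKrullDim V.left

/-- The Zariski topology on `A^Ω` (`A` the set of `K`-points of `X`), induced from the
Zariski topology of the fibered power `X^Ω` via the identification of `A^Ω` with a
subset (the set of closed points, for `K` algebraically closed) of `X^Ω`. -/
def cfgTop (Ω : Type) [Finite Ω] : TopologicalSpace (Ω → Pt K V) :=
  TopologicalSpace.induced (fun u => ev K (ptPow K V Ω u)) inferInstance

/-- The Krull dimension of a subset `D ⊆ A^Ω` for the Zariski topology. -/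
def cfgDim (Ω : Type) [Finite Ω] (D : Set (Ω → Pt K V)) : WithBot ℕ∞ :=
  letI := cfgTop K V Ω
  topologicalKrullDim D

/-- `D ⊆ A^Ω` is closed for the Zariski topology. -/
def cfgClosed (Ω : Type) [Finite Ω] (D : Set (Ω → Pt K V)) : Prop :=
  letI := cfgTop K V Ω
  IsClosed D

/-- `D ⊆ A^Ω` is constructible for the Zariski topology. -/
def cfgConstr (Ω : Type) [Finite Ω] (D : Set (Ω → Pt K V)) : Prop :=
  letI := cfgTop K V Ω
  IsConstr D

/-! ## Configurations, restrictions, cylinders -/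

variable {G : Type} [Group G]

/-- The restriction `Γ_Ω ⊆ A^Ω` of a set of configurations `Γ ⊆ A^G`. -/
def restr (Γ : Set (G → Pt K V)) (Ω : Finset G) : Set (↥Ω → Pt K V) :=
  (fun c (ω : ↥Ω) => c ω) '' Γ

/-- The cylinder `D_p ⊆ A^G`: configurations restricting to an element of `D` on `Ω` and
to `p` on `G ∖ Ω`. -/
def cyl (Ω : Finset G) (D : Set (↥Ω → Pt K V)) (p : {g : G // g ∉ Ω} → Pt K V) :
    Set (G → Pt K V) :=
  {c | (fun ω : ↥Ω => c ω) ∈ D ∧ ∀ (g : G) (h : g ∉ Ω), c g = p ⟨g, h⟩}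

/-- Algebraic mean dimension of `Γ ⊆ A^G` with respect to a Følner net. -/
def mdim (𝓕 : FolnerNet G) (Γ : Set (G → Pt K V)) : EReal :=
  Filter.limsup
    (fun i => dimE (cfgDim K V ↥(𝓕.F i) (restr K V Γ (𝓕.F i))) *
      ((((𝓕.F i).card : ℝ)⁻¹ : ℝ) : EReal))
    Filter.atTop

/-! ## Cellular automata -/

/-- `τ : A^G → A^G` is an algebraic cellular automaton over `(G, X, K)`: it admits a finite
memory set `M ⊆ G` whose associated local defining map `A^M → A` is induced by a morphism
of `K`-schemes `f : X^M → X`. -/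
def IsAlgCA (τ : (G → Pt K V) → (G → Pt K V)) : Prop :=
  ∃ (M : Finset G) (f : pow K V ↥M ⟶ V),
    ∀ (x : G → Pt K V) (g : G),
      τ x g = ptPow K V ↥M (fun m => x (g * (m : G))) ≫ f

/-- Pre-injectivity: configurations that are almost equal and have the same image are equal. -/
def PreInjective (τ : (G → Pt K V) → (G → Pt K V)) : Prop :=
  ∀ c₁ c₂ : G → Pt K V, {g : G | c₁ g ≠ c₂ g}.Finite → τ c₁ = τ c₂ → c₁ = c₂

/-- `(*)`-pre-injectivity: there exist no finite subset `Ω ⊆ G` and Zariski-closed proper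
subset `H ⊊ A^Ω` such that `τ((A^Ω)_p) = τ(H_p)` for all `p ∈ A^{G∖Ω}`. -/
def StarPreInjective (τ : (G → Pt K V) → (G → Pt K V)) : Prop :=
  ¬ ∃ (Ω : Finset G) (H : Set (↥Ω → Pt K V)), cfgClosed K V ↥Ω H ∧ H ≠ Set.univ ∧
      ∀ p : {g : G // g ∉ Ω} → Pt K V,
        τ '' cyl K V Ω Set.univ p = τ '' cyl K V Ω H p

/-- `(**)`-pre-injectivity: there is no finite subset `Ω ⊆ G` such that, for every
`p ∈ A^{G∖Ω}`, the finite-support set `τ((A^Ω)_p)` (written as some `R_s`) satisfies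
`dim(R) < dim(A^Ω)`. -/
def StarStarPreInjective (τ : (G → Pt K V) → (G → Pt K V)) : Prop :=
  ¬ ∃ Ω : Finset G, ∀ p : {g : G // g ∉ Ω} → Pt K V,
      ∃ (Λ : Finset G) (R : Set (↥Λ → Pt K V)) (s : {g : G // g ∉ Λ} → Pt K V),
        τ '' cyl K V Ω Set.univ p = cyl K V Λ R s ∧
        cfgDim K V ↥Λ R < cfgDim K V ↥Ω (Set.univ : Set (↥Ω → Pt K V))

/-- `Γ ⊆ A^G` is closed for the prodiscrete topology on `A^G`. -/
def ProdiscreteClosed {A : Type} (Γ : Set (G → A)) : Prop :=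
  letI : TopologicalSpace A := ⊥
  IsClosed Γ

/-- `Γ ⊆ A^G` is invariant under the shift action of `G`. -/
def ShiftInvariant {A : Type} (Γ : Set (G → A)) : Prop :=
  ∀ (g : G), ∀ c ∈ Γ, (fun h : G => c (g⁻¹ * h)) ∈ Γ

/-- An `(E,E')`-tiling of `G`. -/
def IsTiling (E E' : Finset G) (T : Set G) : Prop :=
  (∀ g ∈ T, ∀ h ∈ T, g ≠ h →
    Disjoint ((g * ·) '' (E : Set G)) ((h * ·) '' (E : Set G))) ∧
  ∀ x : G, ∃ g ∈ T, x ∈ (g * ·) '' (E' : Set G)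

section Points

variable {K : Type} [Field K] {W Y Z : Over (SpecK K)}

theorem ev_comp (a : Pt K Y) (f : Y ⟶ Z) : ev K (a ≫ f) = f.left (ev K a) := by
  simp [ev]

theorem specPt_eq_closedPoint : specPt K = IsLocalRing.closedPoint K :=
  Subsingleton.elim (α := PrimeSpectrum K) _ _

variable [IsAlgClosed K]

theorem exists_ev_mem [LocallyOfFiniteType W.hom] {C : Set W.left} (hC : C.Nonempty)
    (hC' : IsLocallyClosed C) : ∃ a : Pt K W, ev K a ∈ C := by
  have : JacobsonSpace W.left := LocallyOfFiniteType.jacobsonSpace W.hom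
  obtain ⟨w, hw, hwc⟩ := nonempty_inter_closedPoints hC hC'
  refine ⟨Over.homMk (pointOfClosedPoint W.hom w hwc) (pointOfClosedPoint_comp W.hom w hwc), ?_⟩
  have : ev K (W := W) (Over.homMk (pointOfClosedPoint W.hom w hwc)
      (pointOfClosedPoint_comp W.hom w hwc)) = w :=
    pointOfClosedPoint_apply W.hom w hwc _
  rwa [this]

theorem ev_injective [LocallyOfFiniteType W.hom] : Function.Injective (ev K (W := W)) := by
  intro a b h
  ext1
  have ha := Over.w a
  have hb := Over.w b
  exact ext_of_apply_closedPoint_eq W.hom ha hb (by rwa [← specPt_eq_closedPoint])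

theorem isClosed_singleton_ev [LocallyOfFiniteType W.hom] (a : Pt K W) :
    IsClosed {ev K a} := by
  rw [ev, specPt_eq_closedPoint]
  exact ((pointEquivClosedPoint W.hom) ⟨a.left, Over.w a⟩).2

theorem exists_lift_ev [LocallyOfFiniteType Y.hom] [LocallyOfFiniteType Z.hom] (f : Y ⟶ Z)
    {C : Set Y.left} (hC : IsLocallyClosed C) (b : Pt K Z) (hb : ev K b ∈ f.left '' C) :
    ∃ a : Pt K Y, ev K a ∈ C ∧ a ≫ f = b := by
  obtain ⟨y, hy, hyb⟩ := hb
  obtain ⟨a, ha, hab⟩ := exists_ev_mem (C := C ∩ f.left ⁻¹' {ev K b}) ⟨y, hy, hyb⟩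
    (hC.inter ((isClosed_singleton_ev b).preimage f.left.continuous).isLocallyClosed)
  exact ⟨a, ha, ev_injective ((ev_comp a f).trans hab)⟩

theorem universallyInjective_of_injective_points [LocallyOfFiniteType Y.hom]
    [IsSeparated Y.hom] (f : Y ⟶ Z) (hf : Function.Injective fun a : Pt K Y => a ≫ f) :
    UniversallyInjective f.left := by
  have hs : IsSeparated f.left := by
    have : IsSeparated (f.left ≫ Z.hom) := by simpa using ‹IsSeparated Y.hom›
    exact IsSeparated.of_comp f.left Z.hom
  have hl : LocallyOfFiniteType f.left := by
    have : LocallyOfFiniteType (f.left ≫ Z.hom) := by simpa using ‹LocallyOfFiniteType Y.hom›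
    exact locallyOfFiniteType_of_comp f.left Z.hom
  rw [UniversallyInjective.iff_diagonal]
  have hc := (pullback.diagonal f.left).isClosedEmbedding.isClosed_range
  refine ⟨Set.range_eq_univ.mp ?_⟩
  by_contra hne
  let P : Over (SpecK K) := Over.mk (pullback.fst f.left f.left ≫ Y.hom)
  have : LocallyOfFiniteType P.hom := by dsimp [P]; infer_instance
  obtain ⟨a, ha⟩ := exists_ev_mem (W := P) (Set.nonempty_compl.mpr hne)
    hc.isOpen_compl.isLocallyClosed
  have hw := Over.w a
  let p : P ⟶ Y := Over.homMk (pullback.fst f.left f.left) rfl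
  let q : P ⟶ Y := Over.homMk (pullback.snd f.left f.left) (by
    have h1 := Over.w f
    simp only [P, Over.mk_hom, ← h1]
    exact (pullback.condition_assoc _).symm)
  have hpq : a ≫ p = a ≫ q := hf (by
    ext1
    simp [p, q, pullback.condition])
  have h2 : (a ≫ p).left ≫ pullback.diagonal f.left = a.left := by
    apply pullback.hom_ext
    · simp [p]
    · rw [hpq]; simp [q]
  refine ha ⟨(a ≫ p).left (specPt K), ?_⟩
  rw [← Scheme.Hom.comp_apply, h2]
  rfl

end Points

section Powers

variable {K : Type} [Field K] {V T : Over (SpecK K)} {Ω : Type} [Finite Ω]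

/-- The morphism to a fibered power with given components. -/
def powLift (x : Ω → (T ⟶ V)) : T ⟶ pow K V Ω := Pi.lift x

/-- The projections of a fibered power. -/
def powProj (V : Over (SpecK K)) (i : Ω) : pow K V Ω ⟶ V := Pi.π (fun _ : Ω => V) i

@[simp]
theorem powLift_proj (x : Ω → (T ⟶ V)) (i : Ω) : powLift x ≫ powProj V i = x i :=
  Pi.lift_π _ _

theorem pow_hom_ext {x y : T ⟶ pow K V Ω} (h : ∀ i, x ≫ powProj V i = y ≫ powProj V i) :
    x = y :=
  Pi.hom_ext _ _ h

end Powers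

section FieldPoints

variable (K : Type) [Field K]

/-- The spectrum of a `K`-algebra, as a `K`-scheme. -/
abbrev specOver (R : Type) [CommRing R] [Algebra K R] : Over (SpecK K) :=
  Over.mk (Spec.map (CommRingCat.ofHom (algebraMap K R)))

variable {K}

/-- The morphism of spectra induced by a homomorphism of `K`-algebras. -/
def specOverMap {R S : Type} [CommRing R] [Algebra K R] [CommRing S] [Algebra K S]
    (φ : R →ₐ[K] S) : specOver K S ⟶ specOver K R :=
  Over.homMk (Spec.map (CommRingCat.ofHom φ.toRingHom)) (by
    change Spec.map _ ≫ Spec.map _ = Spec.map _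
    rw [← Spec.map_comp, ← CommRingCat.ofHom_comp]
    exact congrArg (fun f => Spec.map (CommRingCat.ofHom f)) φ.comp_algebraMap)

theorem specOverMap_comp {R S T : Type} [CommRing R] [Algebra K R] [CommRing S] [Algebra K S]
    [CommRing T] [Algebra K T] (φ : R →ₐ[K] S) (ψ : S →ₐ[K] T) :
    specOverMap (ψ.comp φ) = specOverMap ψ ≫ specOverMap φ := by
  ext1
  simp only [specOverMap, Over.homMk_left, Over.comp_left]
  rw [← Spec.map_comp, ← CommRingCat.ofHom_comp]
  rfl

theorem exists_eq_specOverMap {R S : Type} [CommRing R] [Algebra K R] [CommRing S] [Algebra K S]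
    (h : specOver K S ⟶ specOver K R) : ∃ φ : R →ₐ[K] S, h = specOverMap φ := by
  obtain ⟨g, hg⟩ := Spec.map_surjective h.left
  have hw : h.left ≫ Spec.map _ = Spec.map _ := Over.w h
  rw [← hg, ← Spec.map_comp] at hw
  have hw' := Spec.map_injective hw
  refine ⟨{ g.hom with commutes' := fun r => ?_ }, ?_⟩
  · exact congrArg (fun f => f.hom r) hw'
  · ext1
    exact hg.symm

theorem specOverMap_injective {R S : Type} [CommRing R] [Algebra K R] [CommRing S] [Algebra K S]
    {φ ψ : R →ₐ[K] S} (h : specOverMap φ = specOverMap ψ) : φ = ψ := by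
  have h1 : (specOverMap φ).left = (specOverMap ψ).left := by rw [h]
  have h2 := Spec.map_injective h1
  ext r
  exact congrArg (fun f => f.hom r) h2

variable {L : Type} [Field L] [Algebra K L] {W Y Z : Over (SpecK K)}

/-- An `L`-point of a `K`-scheme is defined over the intermediate field `E` if it factors
through the spectrum of `E`. -/
def DefinedOver (E : IntermediateField K L) (x : specOver K L ⟶ W) : Prop :=
  ∃ x' : specOver K E ⟶ W, specOverMap E.val ≫ x' = x

theorem DefinedOver.mono {E E' : IntermediateField K L} (hE : E ≤ E') {x : specOver K L ⟶ W}
    (hx : DefinedOver E x) : DefinedOver E' x := by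
  obtain ⟨x', rfl⟩ := hx
  refine ⟨specOverMap (IntermediateField.inclusion hE) ≫ x', ?_⟩
  rw [← Category.assoc, ← specOverMap_comp]
  rfl

theorem DefinedOver.comp {E : IntermediateField K L} {x : specOver K L ⟶ Y}
    (hx : DefinedOver E x) (f : Y ⟶ Z) : DefinedOver E (x ≫ f) := by
  obtain ⟨x', rfl⟩ := hx
  exact ⟨x' ≫ f, by simp⟩

theorem DefinedOver.pow {V : Over (SpecK K)} {Ω : Type} [Finite Ω] {E : IntermediateField K L}
    {x : Ω → (specOver K L ⟶ V)} (hx : ∀ i, DefinedOver E (x i)) :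
    DefinedOver E (powLift x) := by
  choose x' hx' using hx
  refine ⟨powLift x', pow_hom_ext fun i => ?_⟩
  rw [Category.assoc, powLift_proj, powLift_proj, hx']

theorem DefinedOver.of_comp [IsAlgClosed K] [LocallyOfFiniteType Y.hom]
    [IsSeparated Y.hom] (f : Y ⟶ Z) (hf : Function.Injective fun a : Pt K Y => a ≫ f)
    {E : IntermediateField K L} [IsAlgClosed E] {x : specOver K L ⟶ Y}
    (hx : DefinedOver E (x ≫ f)) : DefinedOver E x := by
  have hl : LocallyOfFiniteType f.left := by
    have : LocallyOfFiniteType (f.left ≫ Z.hom) := by simpa using ‹LocallyOfFiniteType Y.hom›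
    exact locallyOfFiniteType_of_comp f.left Z.hom
  obtain ⟨z, hz⟩ := hx
  let P : Over (SpecK E) := Over.mk (pullback.snd f.left z.left)
  have : LocallyOfFiniteType P.hom := by dsimp [P]; infer_instance
  let p : Spec (.of L) ⟶ pullback f.left z.left :=
    pullback.lift x.left (specOverMap E.val).left (congrArg (fun g => g.left) hz).symm
  obtain ⟨a, -⟩ := exists_ev_mem (W := P) (C := Set.univ)
    ⟨p (IsLocalRing.closedPoint L), trivial⟩ isClosed_univ.isLocallyClosed
  have ha : a.left ≫ pullback.snd f.left z.left = 𝟙 _ := Over.w a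
  have hax : (a.left ≫ pullback.fst f.left z.left) ≫ f.left = z.left := by
    rw [Category.assoc, pullback.condition, ← Category.assoc, ha, Category.id_comp]
  let x' : specOver K E ⟶ Y := Over.homMk (a.left ≫ pullback.fst f.left z.left) (by
    rw [← Over.w f, ← Category.assoc, hax, Over.w z])
  refine ⟨x', ?_⟩
  ext1
  have hu := universallyInjective_of_injective_points f hf
  have hu' := ((tfae_universallyInjective f.left).out 0 1).mp hu
  refine @hu' L _ (specOverMap E.val ≫ x').left x.left ?_
  change ((specOverMap E.val).left ≫ (a.left ≫ pullback.fst f.left z.left)) ≫ f.left =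
    x.left ≫ f.left
  rw [Category.assoc, hax]
  exact congrArg (fun g => g.left) hz

/-- The `K`-algebra structure on the residue field of a point of a `K`-scheme. -/
instance residueFieldAlgebra (W : Over (SpecK K)) (w : W.left) :
    Algebra K (W.left.residueField w) :=
  (Spec.preimage (W.left.fromSpecResidueField w ≫ W.hom)).hom.toAlgebra

/-- The canonical point of a `K`-scheme with values in a residue field. -/
def residuePoint (W : Over (SpecK K)) (w : W.left) :
    specOver K (W.left.residueField w) ⟶ W :=
  Over.homMk (W.left.fromSpecResidueField w) (Spec.map_preimage _).symm

instance (W : Over (SpecK K)) (w : W.left) : Mono (residuePoint W w) := by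
  have : Mono (residuePoint W w).left := by
    dsimp [residuePoint]; infer_instance
  exact Over.mono_of_mono_left _

theorem residuePoint_apply (w : W.left) (s) : (residuePoint W w).left s = w :=
  Scheme.fromSpecResidueField_apply _ _

/-- The unique point of the spectrum of a field. -/
def fieldPt (L : Type) [Field L] [Algebra K L] : (specOver K L).left :=
  (IsLocalRing.closedPoint L : PrimeSpectrum L)

theorem eq_fieldPt (s : (specOver K L).left) : s = fieldPt L :=
  Subsingleton.elim (α := PrimeSpectrum L) _ _

/-- The underlying point of a field-valued point. -/
def img (x : specOver K L ⟶ W) : W.left := x.left (fieldPt L)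

theorem img_comp (x : specOver K L ⟶ Y) (f : Y ⟶ Z) : img (x ≫ f) = f.left (img x) := by
  simp [img]

theorem img_specOverMap_comp {R : Type} [Field R] [Algebra K R] (φ : R →ₐ[K] L)
    (x : specOver K R ⟶ W) : img (specOverMap φ ≫ x) = img x := by
  rw [img_comp, eq_fieldPt (img (specOverMap φ))]
  rfl

theorem img_residuePoint (w : W.left) : img (residuePoint W w) = w :=
  Scheme.fromSpecResidueField_apply _ _

theorem exists_specMap_fromSpecResidueField {X : Scheme} (f : Spec (.of L) ⟶ X) {w : X}
    (hw : f (IsLocalRing.closedPoint L) = w) :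
    ∃ g : X.residueField w ⟶ .of L, Spec.map g ≫ X.fromSpecResidueField w = f := by
  subst hw
  exact ⟨_, Scheme.descResidueField_stalkClosedPointTo_fromSpecResidueField L X f⟩

theorem exists_eq_comp_residuePoint (x : specOver K L ⟶ W) {w : W.left} (hw : img x = w) :
    ∃ φ : W.left.residueField w →ₐ[K] L, x = specOverMap φ ≫ residuePoint W w := by
  obtain ⟨d, hd⟩ := exists_specMap_fromSpecResidueField x.left hw
  let g : specOver K L ⟶ specOver K (W.left.residueField w) := Over.homMk (Spec.map d) (by
    rw [← Over.w (residuePoint W w), ← Category.assoc, ← Over.w x]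
    exact congrArg (fun k => k ≫ W.hom) hd)
  obtain ⟨φ, hφ⟩ := exists_eq_specOverMap g
  refine ⟨φ, ?_⟩
  rw [← hφ]
  ext1
  exact hd.symm

theorem range_le_of_definedOver {w : W.left} {φ : W.left.residueField w →ₐ[K] L}
    {E : IntermediateField K L} (h : DefinedOver E (specOverMap φ ≫ residuePoint W w)) :
    φ.fieldRange ≤ E := by
  obtain ⟨x', hx'⟩ := h
  have hw : img x' = w := by
    rw [← img_specOverMap_comp E.val, hx', img_specOverMap_comp, img_residuePoint]
  obtain ⟨ψ, rfl⟩ := exists_eq_comp_residuePoint x' hw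
  rw [← Category.assoc, cancel_mono, ← specOverMap_comp] at hx'
  rw [← specOverMap_injective hx']
  rintro _ ⟨r, rfl⟩
  exact (ψ r).2

end FieldPoints

section TranscendenceDegree

variable (K : Type) [Field K] {L : Type} [Field L] [Algebra K L]

/-- The relative algebraic closure in `L` of the field generated by a set. -/
def acl (s : Set L) : IntermediateField K L :=
  (algebraicClosure (IntermediateField.adjoin K s) L).restrictScalars K

variable {K}

theorem mem_acl {s : Set L} {a : L} :
    a ∈ acl K s ↔ IsAlgebraic (IntermediateField.adjoin K s) a := by
  rw [acl, IntermediateField.mem_restrictScalars, mem_algebraicClosure_iff]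

theorem acl_mono {s t : Set L} (h : s ⊆ t) : acl K s ≤ acl K t := by
  intro a ha
  rw [mem_acl] at ha ⊢
  have hst := IntermediateField.adjoin.mono K s t h
  algebraize [(IntermediateField.inclusion hst).toRingHom]
  have : IsScalarTower (IntermediateField.adjoin K s) (IntermediateField.adjoin K t) L :=
    IsScalarTower.of_algebraMap_eq (congrFun rfl)
  exact ha.extendScalars (IntermediateField.inclusion_injective hst)

instance [IsAlgClosed L] (s : Set L) : IsAlgClosed (acl K s) :=
  (algebraicClosure.isAlgClosure (IntermediateField.adjoin K s) L).isAlgClosed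

theorem mem_acl_iff_mem_closure {s : Set L} {a : L} :
    a ∈ acl K s ↔ a ∈ (AlgebraicIndependent.matroid K L).closure s := by
  rw [mem_acl, IntermediateField.isAlgebraic_adjoin_iff,
    AlgebraicIndependent.matroid_closure_eq, SetLike.mem_coe, Subalgebra.mem_algebraicClosure]

theorem card_le_of_mem_acl {ι : Type} {x : ι → L} (hx : AlgebraicIndependent K x)
    (s : Finset L) (h : ∀ i, x i ∈ acl K (s : Set L)) : Nat.card ι ≤ s.card := by
  have h1 : (AlgebraicIndependent.matroid K L).Indep (Set.range x) := hx.coe_range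
  have h2 : Set.range x ⊆ (AlgebraicIndependent.matroid K L).closure s := by
    rintro _ ⟨i, rfl⟩
    exact mem_acl_iff_mem_closure.mp (h i)
  have h3 := Matroid.eRk_mono (AlgebraicIndependent.matroid K L) h2
  rw [h1.eRk_eq_encard, Matroid.eRk_closure_eq] at h3
  have h4 := h3.trans (Matroid.eRk_le_encard _ _)
  rw [← Set.image_univ, hx.injective.encard_image, Set.encard_coe_eq_coe_finsetCard,
    Set.encard_univ] at h4
  rw [Nat.card, ← ENat.toNat_natCast s.card]
  exact ENat.toNat_le_toNat h4 (by simp)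

theorem map_mem_acl {κ : Type} [Field κ] [Algebra K κ] (φ : κ →ₐ[K] L) {s : Set κ} {a : κ}
    (ha : a ∈ acl K s) : φ a ∈ acl K (φ '' s) := by
  rw [mem_acl] at ha ⊢
  have hm : ∀ b ∈ IntermediateField.adjoin K s, φ b ∈ IntermediateField.adjoin K (φ '' s) := by
    intro b hb
    rw [← IntermediateField.adjoin_map]
    exact ⟨b, hb, rfl⟩
  let f : IntermediateField.adjoin K s →ₐ[K] IntermediateField.adjoin K (φ '' s) :=
    (φ.comp (IntermediateField.adjoin K s).val).codRestrict
      (IntermediateField.adjoin K (φ '' s)).toSubalgebra fun b => hm b b.2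
  exact ha.ringHom_of_comp_eq f.toRingHom φ.toRingHom f.toRingHom.injective rfl

theorem exists_finset_fieldRange_le {κ : Type} [Field κ] [Algebra K κ] (φ : κ →ₐ[K] L) {n : ℕ}
    (hn : Algebra.trdeg K κ ≤ n) :
    ∃ s : Finset L, s.card ≤ n ∧ φ.fieldRange ≤ acl K (s : Set L) := by
  classical
  obtain ⟨ι, b, hb⟩ := exists_isTranscendenceBasis' K κ
  have hι : Cardinal.mk ι ≤ n := hb.cardinalMk_eq_trdeg.trans_le hn
  have := Cardinal.lt_aleph0_iff_finite.mp (hι.trans_lt (Cardinal.natCast_lt_aleph0))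
  have := Fintype.ofFinite ι
  refine ⟨Finset.univ.image (φ ∘ b), ?_, ?_⟩
  · refine Finset.card_image_le.trans ?_
    rw [Cardinal.mk_fintype] at hι
    exact_mod_cast hι
  · rintro _ ⟨a, rfl⟩
    have ha : a ∈ acl K (Set.range b) := by
      rw [mem_acl]
      exact hb.isAlgebraic_field.isAlgebraic a
    have h := map_mem_acl φ ha
    rwa [← Set.range_comp, ← Set.image_univ, ← Finset.coe_univ, ← Finset.coe_image] at h

theorem trdeg_lt_of_surjective {R S : Type} [CommRing R] [IsDomain R] [Algebra K R] [CommRing S]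
    [IsDomain S] [Algebra K S] (f : R →ₐ[K] S) (hf : Function.Surjective f)
    (hf' : ¬ Function.Injective f) (hR : Algebra.trdeg K R < Cardinal.aleph0) :
    Algebra.trdeg K S < Algebra.trdeg K R := by
  by_contra! hle
  obtain ⟨ι, b, hb⟩ := exists_isTranscendenceBasis' K S
  have hι := hb.cardinalMk_eq_trdeg
  have := Cardinal.lt_aleph0_iff_finite.mp
    ((hι.trans_le (trdeg_le_of_surjective f hf)).trans_lt hR)
  choose b' hb' using fun i => hf (b i)
  have hfb : f ∘ b' = b := funext hb'
  have hbi : AlgebraicIndependent K b' := AlgebraicIndependent.of_comp f (hfb ▸ hb.1)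
  have hbt := hbi.isTranscendenceBasis_of_trdeg_le_of_finite (hle.trans hι.ge)
  obtain ⟨r, hr, hr0⟩ : ∃ r, f r = 0 ∧ r ≠ 0 := by
    rw [injective_iff_map_eq_zero] at hf'
    push Not at hf'
    exact hf'
  have hra := hbt.isAlgebraic.isAlgebraic r
  obtain ⟨p, hp0, c, hc⟩ := hra.exists_nonzero_dvd (mem_nonZeroDivisors_of_ne_zero hr0)
  obtain ⟨q, hq⟩ : ∃ q, MvPolynomial.aeval b' q = (p : R) := by
    exact (Algebra.adjoin_range_eq_range_aeval K b').le p.2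
  have hfq : MvPolynomial.aeval b q = 0 := by
    have hc' : (p : R) = r * c := hc
    have h := MvPolynomial.comp_aeval_apply b' f q
    rw [hq, hc', map_mul, hr, zero_mul] at h
    rw [h, ← hfb]
    rfl
  have hq0 : q = 0 := hb.1 (by simpa using hfq)
  refine hp0 (Subtype.ext ?_)
  rw [← hq, hq0, map_zero, ZeroMemClass.coe_zero]

end TranscendenceDegree

section Dimension

variable {K : Type} [Field K] {W : Over (SpecK K)}

theorem trdeg_le_of_forall_eq_top {κ : Type} [Field κ] [Algebra K κ] (A : Subalgebra K κ)
    (h : ∀ E : IntermediateField K κ, A ≤ E.toSubalgebra → E = ⊤) :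
    Algebra.trdeg K κ ≤ Algebra.trdeg K A := by
  have h1 : Algebra.IsAlgebraic (IntermediateField.adjoin K (A : Set κ)) κ := by
    rw [h _ fun a ha => IntermediateField.subset_adjoin K (A : Set κ) ha]
    exact ⟨fun a => isAlgebraic_algebraMap (⟨a, trivial⟩ : (⊤ : IntermediateField K κ))⟩
  rw [IntermediateField.isAlgebraic_adjoin_iff_top, Algebra.adjoin_eq] at h1
  have := trdeg_add_eq (R := K) (S := A) (A := κ)
  rw [trdeg_eq_zero (R := A), add_zero] at this
  exact this.ge

theorem exists_affine_chart [LocallyOfFiniteType W.hom] (w : W.left) :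
    ∃ (B : CommRingCat.{0}) (_ : Algebra K B) (_ : Algebra.FiniteType K B) (j : specOver K B ⟶ W),
      IsOpenImmersion j.left ∧ w ∈ Set.range j.left := by
  obtain ⟨U, hU, hw, -⟩ := exists_isAffineOpen_mem_and_subset (x := w) (U := ⊤) trivial
  obtain ⟨α, hα⟩ := Spec.map_surjective (hU.fromSpec ≫ W.hom)
  let : Algebra K Γ(W.left, U) := α.hom.toAlgebra
  have hα' : (CommRingCat.ofHom (algebraMap K Γ(W.left, U))) = α := rfl
  refine ⟨Γ(W.left, U), inferInstance, ?_, Over.homMk hU.fromSpec hα.symm, ?_, ?_⟩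
  · have : LocallyOfFiniteType (Spec.map α) := by rw [hα]; infer_instance
    exact (HasRingHomProperty.Spec_iff (P := @LocallyOfFiniteType)).mp this
  · exact inferInstanceAs (IsOpenImmersion hU.fromSpec)
  · change w ∈ Set.range hU.fromSpec
    rw [hU.range_fromSpec]
    exact hw

theorem exists_residuePoint_eq {B : Type} [CommRing B] [Algebra K B] (j : specOver K B ⟶ W)
    [IsOpenImmersion j.left] {w : W.left} (hw : w ∈ Set.range j.left) :
    ∃ φ : B →ₐ[K] W.left.residueField w, residuePoint W w = specOverMap φ ≫ j := by
  have hr : Set.range (residuePoint W w).left ⊆ Set.range j.left := by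
    rintro _ ⟨s, rfl⟩
    rwa [residuePoint_apply]
  have hl := IsOpenImmersion.lift_fac j.left (residuePoint W w).left hr
  let g : specOver K (W.left.residueField w) ⟶ specOver K B :=
    Over.homMk (IsOpenImmersion.lift j.left (residuePoint W w).left hr) (by
      rw [← Over.w j, ← Category.assoc, hl, Over.w])
  obtain ⟨φ, hφ⟩ := exists_eq_specOverMap g
  refine ⟨φ, ?_⟩
  rw [← hφ]
  ext1
  exact hl.symm

theorem trdeg_residueField_le_range {B : Type} [CommRing B] [Algebra K B] (j : specOver K B ⟶ W)
    {w : W.left} {φ : B →ₐ[K] W.left.residueField w} (hφ : residuePoint W w = specOverMap φ ≫ j) :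
    Algebra.trdeg K (W.left.residueField w) ≤ Algebra.trdeg K φ.range := by
  refine trdeg_le_of_forall_eq_top _ fun E hE => ?_
  have hE' : ∀ b, φ b ∈ E := fun b => hE ⟨b, rfl⟩
  have hd : DefinedOver E (specOverMap (AlgHom.id K _) ≫ residuePoint W w) := by
    refine ⟨specOverMap (φ.codRestrict E.toSubalgebra hE') ≫ j, ?_⟩
    rw [← Category.assoc]
    erw [← specOverMap_comp]
    rw [hφ, ← Category.assoc, ← specOverMap_comp]
    rfl
  exact top_le_iff.mp fun a _ => range_le_of_definedOver hd ⟨a, rfl⟩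

theorem trdeg_residueField_lt_aleph0 [LocallyOfFiniteType W.hom] (w : W.left) :
    Algebra.trdeg K (W.left.residueField w) < Cardinal.aleph0 := by
  obtain ⟨B, _, _, j, _, hw⟩ := exists_affine_chart w
  obtain ⟨φ, hφ⟩ := exists_residuePoint_eq j hw
  have : Algebra.FiniteType K φ.range :=
    Algebra.FiniteType.of_surjective φ.rangeRestrict φ.rangeRestrict_surjective
  exact (trdeg_residueField_le_range j hφ).trans_lt trdeg_lt_aleph0_of_finiteType

theorem img_specOverMap_eq_ker {B κ : Type} [CommRing B] [Algebra K B] [Field κ] [Algebra K κ]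
    (φ : B →ₐ[K] κ) : 
    img (specOverMap φ) = (⟨RingHom.ker φ, RingHom.ker_isPrime φ⟩ : PrimeSpectrum B) := by
  apply PrimeSpectrum.ext
  change Ideal.comap _ (IsLocalRing.maximalIdeal κ) = _
  rw [IsLocalRing.maximalIdeal_eq_bot]
  rfl

theorem exists_surjective_of_specializes {B : Type} [CommRing B] [Algebra K B]
    (j : specOver K B ⟶ W) [IsOpenImmersion j.left] {v w : W.left} (h : v ⤳ w)
    {φ : B →ₐ[K] W.left.residueField v} (hφ : residuePoint W v = specOverMap φ ≫ j)
    {ψ : B →ₐ[K] W.left.residueField w} (hψ : residuePoint W w = specOverMap ψ ≫ j) :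
    ∃ f : φ.range →ₐ[K] ψ.range, Function.Surjective f ∧ (Function.Injective f → v = w) := by
  have hv : j.left (img (specOverMap φ)) = v := by
    rw [← img_comp, ← hφ, img_residuePoint]
  have hw : j.left (img (specOverMap ψ)) = w := by
    rw [← img_comp, ← hψ, img_residuePoint]
  have hs : img (specOverMap φ) ⤳ img (specOverMap ψ) := by
    rw [← hv, ← hw] at h
    exact j.left.isOpenEmbedding.isInducing.specializes_iff.mp h
  have hle : RingHom.ker φ ≤ RingHom.ker ψ := by
    rw [img_specOverMap_eq_ker, img_specOverMap_eq_ker] at hs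
    exact (PrimeSpectrum.le_iff_specializes _ _).mpr hs
  let q := Ideal.Quotient.factorₐ K hle
  refine ⟨(Ideal.quotientKerEquivRange ψ).toAlgHom.comp
    (q.comp (Ideal.quotientKerEquivRange φ).symm.toAlgHom), ?_, fun hf => ?_⟩
  · exact (Ideal.quotientKerEquivRange ψ).surjective.comp
      ((Ideal.Quotient.factor_surjective hle).comp
        (Ideal.quotientKerEquivRange φ).symm.surjective)
  · have hq : Function.Injective q := by
      have h1 : Function.Injective (q ∘ (Ideal.quotientKerEquivRange φ).symm) :=
        Function.Injective.of_comp (f := Ideal.quotientKerEquivRange ψ) hf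
      exact (Function.Injective.of_comp_iff' q
        (Ideal.quotientKerEquivRange φ).symm.bijective).mp h1
    have hker : RingHom.ker φ = RingHom.ker ψ := by
      refine le_antisymm hle fun b hb => ?_
      rw [← Ideal.Quotient.eq_zero_iff_mem] at hb ⊢
      exact hq (by rw [map_zero]; exact hb)
    rw [← hv, ← hw, img_specOverMap_eq_ker, img_specOverMap_eq_ker]
    exact congrArg j.left (PrimeSpectrum.ext hker)

theorem trdeg_residueField_lt_of_specializes [LocallyOfFiniteType W.hom] {v w : W.left}
    (h : v ⤳ w) (hne : v ≠ w) :
    Algebra.trdeg K (W.left.residueField w) < Algebra.trdeg K (W.left.residueField v) := by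
  obtain ⟨B, _, _, j, _, hw⟩ := exists_affine_chart w
  have hv : v ∈ Set.range j.left := h.mem_open j.left.isOpenEmbedding.isOpen_range hw
  obtain ⟨φ, hφ⟩ := exists_residuePoint_eq j hv
  obtain ⟨ψ, hψ⟩ := exists_residuePoint_eq j hw
  obtain ⟨f, hf, hf'⟩ := exists_surjective_of_specializes j h hφ hψ
  have hle := trdeg_le_of_injective φ.range.val Subtype.val_injective
  calc _ ≤ Algebra.trdeg K ψ.range := trdeg_residueField_le_range j hψ
    _ < Algebra.trdeg K φ.range := trdeg_lt_of_surjective f hf (mt hf' hne)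
          (hle.trans_lt (trdeg_residueField_lt_aleph0 v))
    _ ≤ _ := hle

end Dimension

section ProperPowers

variable {K : Type} [Field K]

instance isClosedUnderBinaryProducts_isProper :
    (MorphismProperty.overObj @IsProper (X := SpecK K)).IsClosedUnderBinaryProducts where
  limitsOfShape_le := by
    rintro W ⟨p⟩
    let c : BinaryFan (p.diag.obj ⟨.left⟩) (p.diag.obj ⟨.right⟩) :=
      (Cone.postcompose (diagramIsoPair p.diag).hom).obj p.cone
    have hc : IsLimit c := (IsLimit.postcomposeHomEquiv _ _).symm p.isLimit
    have hp := Over.isPullback_of_binaryFan_isLimit c hc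
    have h1 : IsProper (p.diag.obj ⟨.left⟩).hom := p.prop_diag_obj ⟨.left⟩
    have h2 : IsProper (p.diag.obj ⟨.right⟩).hom := p.prop_diag_obj ⟨.right⟩
    have h3 : IsProper c.fst.left := MorphismProperty.of_isPullback hp.flip h2
    change IsProper W.hom
    have hW : c.fst.left ≫ (p.diag.obj ⟨.left⟩).hom = W.hom := Over.w c.fst
    rw [← hW]
    exact MorphismProperty.comp_mem @IsProper _ _ h3 h1

instance isProper_pow (V : Over (SpecK K)) [h : IsProper V.hom] (Ω : Type) [Finite Ω] :
    IsProper (pow K V Ω).hom := by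
  have : MorphismProperty.ContainsIdentities @IsProper := ⟨fun _ => inferInstance⟩
  have : (MorphismProperty.overObj @IsProper (X := SpecK K)).IsClosedUnderLimitsOfShape
      (Discrete PEmpty.{1}) := CostructuredArrow.closedUnderLimitsOfShape_discrete_empty _
  have := ObjectProperty.IsClosedUnderFiniteProducts.mk'
    (P := MorphismProperty.overObj @IsProper (X := SpecK K))
  exact ObjectProperty.prop_product (MorphismProperty.overObj @IsProper) fun _ => h

theorem isProper_left {Y Z : Over (SpecK K)} [IsProper Y.hom] [IsProper Z.hom] (f : Y ⟶ Z) :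
    IsProper f.left := by
  have : IsProper (f.left ≫ Z.hom) := by rwa [Over.w]
  exact IsProper.of_comp f.left Z.hom

end ProperPowers

section IrreduciblePowers

variable {K : Type} [Field K] {V T T' : Over (SpecK K)}

/-- The constant morphism with value a given `K`-point. -/
def constPt (T : Over (SpecK K)) (a : Pt K V) : T ⟶ V := Over.mkIdTerminal.from T ≫ a

@[simp]
theorem comp_constPt (x : T' ⟶ T) (a : Pt K V) : x ≫ constPt T a = constPt T' a := by
  rw [constPt, ← Category.assoc, Over.mkIdTerminal.hom_ext (x ≫ _) (Over.mkIdTerminal.from T')]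
  rfl

@[simp]
theorem constPt_self (a : Pt K V) : constPt (Over.mk (𝟙 (SpecK K))) a = a := by
  rw [constPt, Over.mkIdTerminal.hom_ext (Over.mkIdTerminal.from _) (𝟙 _), Category.id_comp]

theorem comp_powLift {Ω : Type} [Finite Ω] (y : T' ⟶ T) (x : Ω → (T ⟶ V)) :
    y ≫ powLift x = powLift fun i => y ≫ x i :=
  pow_hom_ext fun i => by simp

/-- The coordinates of a point of a fibered power. -/
theorem powLift_comp_powProj {Ω : Type} [Finite Ω] (y : T ⟶ pow K V Ω) :
    (powLift fun i => y ≫ powProj V i) = y :=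
  pow_hom_ext fun i => by simp

/-- The inclusion of `V` into a fibered power obtained by freezing all coordinates but one. -/
def powUpdate {Ω : Type} [Finite Ω] [DecidableEq Ω] (u : Ω → Pt K V) (i : Ω) : V ⟶ pow K V Ω :=
  powLift (Function.update (fun k => constPt V (u k)) i (𝟙 V))

theorem comp_powUpdate {Ω : Type} [Finite Ω] [DecidableEq Ω] (u : Ω → Pt K V) (i : Ω)
    (x : Pt K V) : x ≫ powUpdate u i = powLift (Function.update u i x) := by
  refine pow_hom_ext fun k => ?_
  rw [powUpdate, Category.assoc, powLift_proj, powLift_proj]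
  by_cases h : k = i
  · subst h; simp
  · simp [h]

variable [IsAlgClosed K] [LocallyOfFiniteType V.hom] [IrreducibleSpace V.left]
  {Ω : Type} [Finite Ω]

theorem exists_eqOn_mem_of_isOpen {A B : Set (pow K V Ω).left} (hA : IsOpen A) (hB : IsOpen B)
    {u v : Ω → Pt K V} (hu : ev K (powLift u) ∈ A) (hv : ev K (powLift v) ∈ B) (s : Set Ω) :
    ∃ u' v' : Ω → Pt K V, ev K (powLift u') ∈ A ∧ ev K (powLift v') ∈ B ∧ Set.EqOn u' v' s := by
  classical
  induction s, s.toFinite using Set.Finite.induction_on with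
  | empty => exact ⟨u, v, hu, hv, Set.eqOn_empty _ _⟩
  | @insert i s his _ ih =>
    obtain ⟨u', v', hu', hv', h⟩ := ih
    have hA' := hA.preimage (powUpdate u' i).left.continuous
    have hB' := hB.preimage (powUpdate v' i).left.continuous
    have hne : ((powUpdate u' i).left ⁻¹' A ∩ (powUpdate v' i).left ⁻¹' B).Nonempty := by
      refine nonempty_preirreducible_inter hA' hB' ⟨ev K (u' i), ?_⟩ ⟨ev K (v' i), ?_⟩
      · rwa [Set.mem_preimage, ← ev_comp, comp_powUpdate, Function.update_eq_self]
      · rwa [Set.mem_preimage, ← ev_comp, comp_powUpdate, Function.update_eq_self]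
    obtain ⟨x, hxA, hxB⟩ := exists_ev_mem hne (hA'.inter hB').isLocallyClosed
    rw [Set.mem_preimage, ← ev_comp, comp_powUpdate] at hxA hxB
    refine ⟨_, _, hxA, hxB, ?_⟩
    rintro k (rfl | hk)
    · simp
    · have hki : k ≠ i := fun hki => his (hki ▸ hk)
      simpa [hki] using h hk

instance irreducibleSpace_pow [LocallyOfFiniteType (pow K V Ω).hom] :
    IrreducibleSpace (pow K V Ω).left := by
  obtain ⟨a, -⟩ := exists_ev_mem (W := V) Set.univ_nonempty isClosed_univ.isLocallyClosed
  have : Nonempty (pow K V Ω).left := ⟨ev K (powLift fun _ => a)⟩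
  refine { isPreirreducible_univ := ?_, toNonempty := this }
  rintro A B hA hB ⟨p, -, hp⟩ ⟨q, -, hq⟩
  obtain ⟨u, hu⟩ := exists_ev_mem ⟨p, hp⟩ hA.isLocallyClosed
  obtain ⟨v, hv⟩ := exists_ev_mem ⟨q, hq⟩ hB.isLocallyClosed
  rw [← powLift_comp_powProj u] at hu
  rw [← powLift_comp_powProj v] at hv
  obtain ⟨u', v', hu', hv', h⟩ := exists_eqOn_mem_of_isOpen hA hB hu hv Set.univ
  rw [Set.eqOn_univ] at h
  subst h
  exact ⟨_, trivial, hu', hv'⟩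

end IrreduciblePowers

section GenericDimension

variable {K : Type} [Field K] {L : Type} [Field L] [Algebra K L]

theorem exists_algHom_of_isTranscendenceBasis [IsAlgClosed L] {κ ι : Type} [Field κ] [Algebra K κ]
    {b : ι → κ} (hb : IsTranscendenceBasis K b) {t : ι → L} (ht : AlgebraicIndependent K t) :
    ∃ ψ : κ →ₐ[K] L, ∀ j, ψ (b j) = t j := by
  let S := Algebra.adjoin K (Set.range b)
  let g : S →ₐ[K] L := (MvPolynomial.aeval t).comp hb.1.aevalEquiv.symm.toAlgHom
  have hg : Function.Injective g := by
    have : Function.Injective (MvPolynomial.aeval (R := K) t) := ht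
    exact this.comp hb.1.aevalEquiv.symm.injective
  let _ : Algebra S L := g.toRingHom.toAlgebra
  have : IsScalarTower K S L := IsScalarTower.of_algebraMap_eq fun r => (g.commutes r).symm
  have : Algebra.IsAlgebraic S κ := hb.isAlgebraic
  have : FaithfulSMul S L := (faithfulSMul_iff_algebraMap_injective S L).mpr hg
  have : Module.IsTorsionFree S L := inferInstance
  let ψ : κ →ₐ[S] L := IsAlgClosed.lift
  refine ⟨ψ.restrictScalars K, fun j => ?_⟩
  have hj : b j = algebraMap S κ (hb.1.aevalEquiv (MvPolynomial.X j)) := by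
    rw [AlgebraicIndependent.algebraMap_aevalEquiv, MvPolynomial.aeval_X]
  rw [AlgHom.restrictScalars_apply, hj, ψ.commutes]
  change MvPolynomial.aeval t (hb.1.aevalEquiv.symm (hb.1.aevalEquiv (MvPolynomial.X j))) = t j
  rw [AlgEquiv.symm_apply_apply, MvPolynomial.aeval_X]

variable {W : Over (SpecK K)}

theorem definedOver_of_fieldRange_le {w : W.left} {φ : W.left.residueField w →ₐ[K] L}
    {E : IntermediateField K L} (h : φ.fieldRange ≤ E) :
    DefinedOver E (specOverMap φ ≫ residuePoint W w) := by
  let φ' : W.left.residueField w →ₐ[K] E :=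
    φ.codRestrict E.toSubalgebra fun r => h ⟨r, rfl⟩
  refine ⟨specOverMap φ' ≫ residuePoint W w, ?_⟩
  rw [← Category.assoc, ← specOverMap_comp]
  rfl

/-- The transcendence degree of the residue field at the generic point. -/
def gdim (W : Over (SpecK K)) [IrreducibleSpace W.left] : ℕ :=
  Cardinal.toNat (Algebra.trdeg K (W.left.residueField (genericPoint W.left)))

theorem trdeg_residueField_genericPoint (W : Over (SpecK K)) [IrreducibleSpace W.left]
    [LocallyOfFiniteType W.hom] :
    Algebra.trdeg K (W.left.residueField (genericPoint W.left)) = gdim W :=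
  (Cardinal.cast_toNat_of_lt_aleph0 (trdeg_residueField_lt_aleph0 _)).symm

theorem exists_definedOver_acl_of_trdeg_le (x : specOver K L ⟶ W) {n : ℕ}
    (hn : Algebra.trdeg K (W.left.residueField (img x)) ≤ n) :
    ∃ s : Finset L, s.card ≤ n ∧ DefinedOver (acl K (s : Set L)) x := by
  obtain ⟨φ, hφ⟩ := exists_eq_comp_residuePoint x rfl
  obtain ⟨s, hs, hφs⟩ := exists_finset_fieldRange_le φ hn
  refine ⟨s, hs, ?_⟩
  rw [hφ]
  exact definedOver_of_fieldRange_le hφs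

theorem exists_definedOver_acl_of_ne [IrreducibleSpace W.left] [LocallyOfFiniteType W.hom]
    (x : specOver K L ⟶ W) (hx : img x ≠ genericPoint W.left) :
    ∃ s : Finset L, s.card + 1 ≤ gdim W ∧ DefinedOver (acl K (s : Set L)) x := by
  have hlt := trdeg_residueField_lt_of_specializes
    (genericPoint_specializes (img x)) hx.symm
  rw [trdeg_residueField_genericPoint] at hlt
  obtain ⟨n, hn⟩ := Cardinal.lt_aleph0.mp (hlt.trans (Cardinal.natCast_lt_aleph0))
  obtain ⟨s, hs, hx⟩ := exists_definedOver_acl_of_trdeg_le x hn.le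
  rw [hn] at hlt
  have : n < gdim W := by exact_mod_cast hlt
  exact ⟨s, by lia, hx⟩

theorem exists_definedOver_acl [IrreducibleSpace W.left] [LocallyOfFiniteType W.hom]
    (x : specOver K L ⟶ W) :
    ∃ s : Finset L, s.card ≤ gdim W ∧ DefinedOver (acl K (s : Set L)) x := by
  by_cases hx : img x = genericPoint W.left
  · refine exists_definedOver_acl_of_trdeg_le x ?_
    rw [hx, trdeg_residueField_genericPoint]
  · obtain ⟨s, hs, h⟩ := exists_definedOver_acl_of_ne x hx
    exact ⟨s, by lia, h⟩

theorem exists_forall_definedOver {α : Type} (A : Finset α) {W : α → Over (SpecK K)}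
    (x : ∀ i, specOver K L ⟶ W i) (n : α → ℕ)
    (h : ∀ i ∈ A, ∃ s : Finset L, s.card ≤ n i ∧ DefinedOver (acl K (s : Set L)) (x i)) :
    ∃ s : Finset L, s.card ≤ ∑ i ∈ A, n i ∧ ∀ i ∈ A, DefinedOver (acl K (s : Set L)) (x i) := by
  classical
  choose! s hs hx using h
  refine ⟨A.biUnion s, Finset.card_biUnion_le.trans (Finset.sum_le_sum hs), fun i hi => ?_⟩
  exact (hx i hi).mono (acl_mono (by exact_mod_cast Finset.subset_biUnion_of_mem s hi))

theorem natCard_mul_gdim_le [IrreducibleSpace W.left] [LocallyOfFiniteType W.hom] {α : Type}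
    [Finite α] (φ : α → (W.left.residueField (genericPoint W.left) →ₐ[K] L))
    {ι : Type} {b : ι → W.left.residueField (genericPoint W.left)}
    (hb : IsTranscendenceBasis K b)
    (hφ : AlgebraicIndependent K fun i : α × ι => φ i.1 (b i.2)) (s : Finset L)
    (h : ∀ i, DefinedOver (acl K (s : Set L)) (specOverMap (φ i) ≫ residuePoint W _)) :
    Nat.card α * gdim W ≤ s.card := by
  have hι : Nat.card ι = gdim W := by
    rw [gdim, ← hb.cardinalMk_eq_trdeg]
    rfl
  rw [← hι, ← Nat.card_prod]
  exact card_le_of_mem_acl hφ s fun i => range_le_of_definedOver (h i.1) ⟨b i.2, rfl⟩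

theorem gdim_pow_le (V : Over (SpecK K)) [IrreducibleSpace V.left] [LocallyOfFiniteType V.hom]
    (Ω : Type) [Finite Ω] [IrreducibleSpace (pow K V Ω).left]
    [LocallyOfFiniteType (pow K V Ω).hom] : gdim (pow K V Ω) ≤ Nat.card Ω * gdim V := by
  have := Fintype.ofFinite Ω
  let κ := (pow K V Ω).left.residueField (genericPoint (pow K V Ω).left)
  let L := AlgebraicClosure κ
  let φ : κ →ₐ[K] L := IsScalarTower.toAlgHom K κ L
  let x : specOver K L ⟶ pow K V Ω := specOverMap φ ≫ residuePoint _ _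
  obtain ⟨s, hs, hxs⟩ := exists_forall_definedOver Finset.univ (fun i : Ω => x ≫ powProj V i)
    (fun _ => gdim V) fun i _ => exists_definedOver_acl _
  have hx : DefinedOver (acl K (s : Set L)) x := by
    have h := DefinedOver.pow fun i => hxs i (Finset.mem_univ i)
    rwa [powLift_comp_powProj] at h
  obtain ⟨ι, b, hb⟩ := exists_isTranscendenceBasis' K κ
  have h := natCard_mul_gdim_le (W := pow K V Ω) (fun _ : Unit => φ) hb
    ((hb.1.map' (f := φ) φ.toRingHom.injective).comp _ (Equiv.punitProd ι).injective) s fun _ => hx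
  rw [Finset.sum_const, smul_eq_mul, Finset.card_univ, ← Nat.card_eq_fintype_card] at hs
  simp only [Nat.card_unique, one_mul] at h
  exact h.trans hs

theorem exists_generic_family (V : Over (SpecK K)) [IrreducibleSpace V.left]
    [LocallyOfFiniteType V.hom] (F : Type) [Finite F] :
    ∃ (L : Type) (_ : Field L) (_ : Algebra K L) (_ : IsAlgClosed L)
      (x : F → (specOver K L ⟶ V)), ∀ s : Finset L,
        (∀ i, DefinedOver (acl K (s : Set L)) (x i)) → Nat.card F * gdim V ≤ s.card := by
  obtain ⟨ι, b, hb⟩ :=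
    exists_isTranscendenceBasis' K (V.left.residueField (genericPoint V.left))
  let R := MvPolynomial (F × ι) K
  let L := AlgebraicClosure (FractionRing R)
  have hRL : Function.Injective (IsScalarTower.toAlgHom K R L) := by
    change Function.Injective (algebraMap R L)
    rw [IsScalarTower.algebraMap_eq R (FractionRing R) L]
    exact (algebraMap (FractionRing R) L).injective.comp (IsFractionRing.injective R _)
  have ht : AlgebraicIndependent K fun i => IsScalarTower.toAlgHom K R L (MvPolynomial.X i) :=
    (MvPolynomial.algebraicIndependent_X (F × ι) K).map' hRL
  choose ψ hψ using fun i : F => exists_algHom_of_isTranscendenceBasis hb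
    (ht.comp (fun j : ι => (i, j)) fun _ _ h => (Prod.ext_iff.mp h).2)
  refine ⟨L, inferInstance, inferInstance, inferInstance,
    fun i => specOverMap (ψ i) ≫ residuePoint V _, fun s hs => ?_⟩
  refine natCard_mul_gdim_le ψ hb ?_ s hs
  have hψt : (fun i : F × ι => ψ i.1 (b i.2)) =
      fun i => IsScalarTower.toAlgHom K R L (MvPolynomial.X i) := funext fun i => hψ i.1 i.2
  rw [hψt]
  exact ht

end GenericDimension

theorem exists_maximal_finite_inter {α : Type} {B S : Set (Set α)}
    (hB : ∀ t ⊆ B, t.Finite → ⋂₀ t ∈ B) (hSB : S ⊆ B)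
    (hS : ∀ t ⊆ S, t.Finite → (⋂₀ t).Nonempty) :
    ∃ M, S ⊆ M ∧ M ⊆ B ∧ (∀ t ⊆ M, t.Finite → ⋂₀ t ∈ M ∧ (⋂₀ t).Nonempty) ∧
      ∀ s ∈ B, (∀ m ∈ M, (s ∩ m).Nonempty) → s ∈ M := by
  let F : Set (Set (Set α)) := {M | M ⊆ B ∧ ∀ t ⊆ M, t.Finite → (⋂₀ t).Nonempty}
  have hF : Order.IsOfFiniteCharacter F := by
    refine fun M => ⟨fun h y hy _ => ⟨hy.trans h.1, fun t ht => h.2 t (ht.trans hy)⟩, fun h => ?_⟩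
    refine ⟨fun s hs => (h {s} (Set.singleton_subset_iff.mpr hs) (Set.finite_singleton s)).1 rfl,
      fun t ht htf => (h t ht htf).2 t subset_rfl htf⟩
  obtain ⟨M, hSM, hM⟩ := hF.exists_maximal (show S ∈ F from ⟨hSB, hS⟩)
  have hMF : M ∈ F := hM.prop
  have key : ∀ s ∈ B, (∀ t ⊆ M, t.Finite → (s ∩ ⋂₀ t).Nonempty) → s ∈ M := by
    intro s hs h
    refine Maximal.mem_of_prop_insert hM ⟨Set.insert_subset hs hMF.1, fun t ht htf => ?_⟩
    obtain ⟨a, has, hat⟩ := h (t \ {s}) (fun u hu => (ht hu.1).resolve_left hu.2)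
      (htf.subset Set.sdiff_subset)
    refine ⟨a, fun u hu => ?_⟩
    by_cases hus : u = s
    · rwa [hus]
    · exact hat u ⟨hu, hus⟩
  have hinter : ∀ t ⊆ M, t.Finite → ⋂₀ t ∈ M := fun t ht htf =>
    key _ (hB t (ht.trans hMF.1) htf) fun t' ht' htf' => by
      rw [← Set.sInter_union]
      exact hMF.2 _ (Set.union_subset ht ht') (htf.union htf')
  exact ⟨M, hSM, hMF.1, fun t ht htf => ⟨hinter t ht htf, hMF.2 t ht htf⟩,
    fun s hs h => key s hs fun t ht htf => h _ (hinter t ht htf)⟩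

section Compactness

variable {K : Type} [Field K] {V : Over (SpecK K)} {G : Type}

/-- The restriction morphism between fibered powers. -/
def powRes (V : Over (SpecK K)) {Λ Λ' : Finset G} (h : Λ ⊆ Λ') : pow K V Λ' ⟶ pow K V Λ :=
  powLift fun i => powProj V ⟨i, h i.2⟩

theorem powLift_comp_powRes {T : Over (SpecK K)} {Λ Λ' : Finset G} (h : Λ ⊆ Λ')
    (x : G → (T ⟶ V)) :
    (powLift fun i : Λ' => x i) ≫ powRes V h = powLift fun i : Λ => x i := by
  rw [powRes, comp_powLift]
  simp

/-- The set of configurations whose restriction to some finite set lies in some given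
Zariski closed set. -/
def IsClosedCyl (s : Set (G → Pt K V)) : Prop :=
  ∃ (Λ : Finset G) (C : Set (pow K V Λ).left), IsClosed C ∧
    s = {c | ev K (powLift fun i : Λ => c i) ∈ C}

theorem isClosedCyl_preimage {Λ : Finset G} {W : Over (SpecK K)} (f : pow K V Λ ⟶ W)
    {D : Set W.left} (hD : IsClosed D) :
    IsClosedCyl {c : G → Pt K V | ev K ((powLift fun i : Λ => c i) ≫ f) ∈ D} :=
  ⟨Λ, f.left ⁻¹' D, hD.preimage f.left.continuous, by simp only [ev_comp]; rfl⟩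

theorem isClosedCyl_proj (g : G) {D : Set V.left} (hD : IsClosed D) :
    IsClosedCyl {c : G → Pt K V | ev K (c g) ∈ D} := by
  have h := isClosedCyl_preimage
    (powProj V (⟨g, Finset.mem_singleton_self g⟩ : ({g} : Finset G))) hD
  simpa using h

theorem IsClosedCyl.exists_of_mem {s : Set (G → Pt K V)} (hs : IsClosedCyl s) (Λ₀ : Finset G) :
    ∃ (Λ : Finset G) (C : Set (pow K V Λ).left), Λ₀ ⊆ Λ ∧ IsClosed C ∧
      s = {c | ev K (powLift fun i : Λ => c i) ∈ C} := by
  classical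
  obtain ⟨Λ, C, hC, rfl⟩ := hs
  have h : Λ ⊆ Λ₀ ∪ Λ := Finset.subset_union_right
  refine ⟨Λ₀ ∪ Λ, (powRes V h).left ⁻¹' C, Finset.subset_union_left,
    hC.preimage (powRes V h).left.continuous, ?_⟩
  ext c
  rw [Set.mem_ofPred_eq, Set.mem_ofPred_eq, Set.mem_preimage, ← ev_comp, powLift_comp_powRes]

theorem IsClosedCyl.inter {s t : Set (G → Pt K V)} (hs : IsClosedCyl s) (ht : IsClosedCyl t) :
    IsClosedCyl (s ∩ t) := by
  obtain ⟨Λ, C, hC, rfl⟩ := hs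
  obtain ⟨Λ', D, hΛ, hD, rfl⟩ := ht.exists_of_mem Λ
  refine ⟨Λ', (powRes V hΛ).left ⁻¹' C ∩ D,
    (hC.preimage (powRes V hΛ).left.continuous).inter hD, ?_⟩
  ext c
  rw [Set.mem_inter_iff, Set.mem_ofPred_eq, Set.mem_ofPred_eq, Set.mem_ofPred_eq, Set.mem_inter_iff,
    Set.mem_preimage, ← ev_comp, powLift_comp_powRes]

theorem isClosedCyl_sInter {t : Set (Set (G → Pt K V))} (ht : ∀ s ∈ t, IsClosedCyl s)
    (htf : t.Finite) : IsClosedCyl (⋂₀ t) := by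
  induction t, htf using Set.Finite.induction_on with
  | empty => exact ⟨∅, Set.univ, isClosed_univ, by simp⟩
  | insert _ _ ih =>
    rw [Set.sInter_insert]
    exact (ht _ (Set.mem_insert _ _)).inter (ih fun s hs => ht s (Set.mem_insert_of_mem _ hs))

theorem exists_forall_mem_of_isClosedCyl [IsAlgClosed K] [IsProper V.hom]
    {S : Set (Set (G → Pt K V))} (hS : ∀ s ∈ S, IsClosedCyl s)
    (hS' : ∀ t ⊆ S, t.Finite → (⋂₀ t).Nonempty) : (⋂₀ S).Nonempty := by
  classical
  obtain ⟨M, hSM, hM, hMi, hMm⟩ := exists_maximal_finite_inter (B := {s | IsClosedCyl s})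
    (fun t ht htf => isClosedCyl_sInter ht htf) hS hS'
  have : CompactSpace (SpecK K) := inferInstance
  have : CompactSpace V.left := QuasiCompact.compactSpace_of_compactSpace V.hom
  have hpt : ∀ g : G, ∃ a : Pt K V, {c | c g = a} ∈ M := by
    intro g
    let 𝓓 : Set (Set V.left) := {D | IsClosed D ∧ {c : G → Pt K V | ev K (c g) ∈ D} ∈ M}
    have hne : (⋂ D : 𝓓, D.1).Nonempty := by
      refine CompactSpace.iInter_nonempty (fun D => D.2.1) fun u => ?_
      obtain ⟨c, hc⟩ := (hMi ((fun D : 𝓓 => {c : G → Pt K V | ev K (c g) ∈ D.1}) '' u)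
        (by rintro _ ⟨D, -, rfl⟩; exact D.2.2) (u.finite_toSet.image _)).2
      refine ⟨ev K (c g), Set.mem_iInter₂.mpr fun D hD => hc _ ⟨D, hD, rfl⟩⟩
    obtain ⟨a, ha⟩ := exists_ev_mem (W := V) hne (isClosed_iInter fun D => D.2.1).isLocallyClosed
    have hag : {c : G → Pt K V | c g = a} = {c | ev K (c g) ∈ ({ev K a} : Set V.left)} := by
      ext c
      exact ev_injective.eq_iff.symm
    refine ⟨a, hMm _ (hag ▸ isClosedCyl_proj g (isClosed_singleton_ev a)) fun m hm => ?_⟩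
    obtain ⟨Λ, C, hΛ, hC, rfl⟩ := (hM hm : IsClosedCyl m).exists_of_mem {g}
    have hg : g ∈ Λ := Finset.singleton_subset_iff.mp hΛ
    let p := powProj V (⟨g, hg⟩ : Λ)
    have := isProper_left p
    have hD : IsClosed (p.left '' C) := p.left.isClosedMap C hC
    have hDM : {c : G → Pt K V | ev K (c g) ∈ p.left '' C} ∈ M := by
      refine hMm _ (isClosedCyl_proj g hD) fun m' hm' => ?_
      obtain ⟨c, hc⟩ := (hMi {_, m'} (Set.pair_subset hm hm') (Set.toFinite _)).2
      refine ⟨c, ⟨_, hc _ (Set.mem_insert _ _), ?_⟩, hc _ (by simp)⟩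
      rw [← ev_comp, powLift_proj]
    obtain ⟨u, huC, hu⟩ := exists_lift_ev p hC.isLocallyClosed a (Set.mem_iInter.mp ha ⟨_, hD, hDM⟩)
    refine ⟨fun h => if hh : h ∈ Λ then u ≫ powProj V (⟨h, hh⟩ : Λ) else a, ?_, ?_⟩
    · simp only [Set.mem_ofPred_eq, hg, dif_pos]
      exact hu
    · rw [Set.mem_ofPred_eq]
      simp only [Finset.coe_mem, dif_pos]
      rwa [powLift_comp_powProj]
  choose a ha using hpt
  refine ⟨a, fun s hs => ?_⟩
  have hsM := hSM hs
  obtain ⟨Λ, C, hC, rfl⟩ := hS s hs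
  obtain ⟨c, hc⟩ := (hMi (insert _ ((fun g : G => {c : G → Pt K V | c g = a g}) '' Λ))
    (Set.insert_subset hsM (by rintro _ ⟨g, -, rfl⟩; exact ha g))
    ((Λ.finite_toSet.image _).insert _)).2
  have hca : (fun i : Λ => c i) = fun i : Λ => a i :=
    funext fun i => hc _ (Set.mem_insert_of_mem _ ⟨i, i.2, rfl⟩)
  have h := hc _ (Set.mem_insert _ _)
  rwa [Set.mem_ofPred_eq, hca] at h

end Compactness

section LocalMaps

variable {K : Type} [Field K] {V T T' : Over (SpecK K)} {G : Type}

open Classical in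
/-- Extension of a finite pattern by a constant. -/
def extendPt (a : Pt K V) {F : Finset G} (x : F → (T ⟶ V)) (g : G) : T ⟶ V :=
  if h : g ∈ F then x ⟨g, h⟩ else constPt T a

theorem extendPt_of_mem (a : Pt K V) {F : Finset G} (x : F → (T ⟶ V)) {g : G} (h : g ∈ F) :
    extendPt a x g = x ⟨g, h⟩ :=
  dif_pos h

theorem extendPt_of_notMem (a : Pt K V) {F : Finset G} (x : F → (T ⟶ V)) {g : G} (h : g ∉ F) :
    extendPt a x g = constPt T a :=
  dif_neg h

theorem comp_extendPt (a : Pt K V) {F : Finset G} (y : T' ⟶ T) (x : F → (T ⟶ V)) (g : G) :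
    y ≫ extendPt a x g = extendPt a (fun i => y ≫ x i) g := by
  by_cases h : g ∈ F
  · rw [extendPt_of_mem a x h, extendPt_of_mem a _ h]
  · rw [extendPt_of_notMem a x h, extendPt_of_notMem a _ h, comp_constPt]

variable [Group G] {M : Finset G}

/-- The cellular automaton with local defining morphism `f`, acting on configurations of
`T`-points. -/
def caMap (f : pow K V M ⟶ V) (c : G → (T ⟶ V)) (g : G) : T ⟶ V :=
  powLift (fun m : M => c (g * m)) ≫ f

theorem comp_caMap (f : pow K V M ⟶ V) (y : T' ⟶ T) (c : G → (T ⟶ V)) (g : G) :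
    y ≫ caMap f c g = caMap f (fun h => y ≫ c h) g := by
  rw [caMap, ← Category.assoc, comp_powLift, caMap]

/-- The morphism induced by a cellular automaton between finite fibered powers, the cells outside
`F` being filled by a constant. -/
def locMap (a : Pt K V) (f : pow K V M ⟶ V) (F S : Finset G) : pow K V F ⟶ pow K V S :=
  powLift fun s : S => caMap f (extendPt a (powProj V)) s

theorem powLift_comp_locMap (a : Pt K V) (f : pow K V M ⟶ V) (F S : Finset G)
    (x : F → (T ⟶ V)) :
    powLift x ≫ locMap a f F S = powLift fun s : S => caMap f (extendPt a x) s := by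
  rw [locMap, comp_powLift]
  simp only [comp_caMap, comp_extendPt, powLift_proj]

theorem locMap_injective (a : Pt K V) (f : pow K V M ⟶ V) (hpre : PreInjective K V (caMap f))
    {F S : Finset G} (hS : ∀ g ∈ F, ∀ m ∈ M, g * m⁻¹ ∈ S) :
    Function.Injective fun u : Pt K (pow K V F) => u ≫ locMap a f F S := by
  intro u v huv
  dsimp only at huv
  rw [← powLift_comp_powProj u, ← powLift_comp_powProj v, powLift_comp_locMap,
    powLift_comp_locMap] at huv
  have hext : (extendPt a fun i => u ≫ powProj V i) = extendPt a fun i => v ≫ powProj V i := by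
    refine hpre _ _ (F.finite_toSet.subset fun g hg => ?_) (funext fun g => ?_)
    · by_contra h
      exact hg ((extendPt_of_notMem a _ h).trans (extendPt_of_notMem a _ h).symm)
    · by_cases hg : g ∈ S
      · simpa using congrArg (fun w => w ≫ powProj V (⟨g, hg⟩ : S)) huv
      · have hgm : ∀ m : M, g * m ∉ F := fun m hm =>
          hg (by simpa using hS _ hm m m.2)
        simp only [caMap, extendPt_of_notMem a _ (hgm _)]
  refine pow_hom_ext fun i => ?_
  simpa only [extendPt_of_mem a _ i.2] using congrFun hext i

theorem exists_caMap_eq [IsAlgClosed K] [IsProper V.hom] (f : pow K V M ⟶ V) (d : G → Pt K V)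
    (h : ∀ Ω : Finset G, ∃ c : G → Pt K V, ∀ g ∈ Ω, caMap f c g = d g) :
    ∃ c : G → Pt K V, caMap f c = d := by
  classical
  obtain ⟨c, hc⟩ := exists_forall_mem_of_isClosedCyl
    (S := Set.range fun g => {c : G → Pt K V | caMap f c g = d g}) (by
      rintro _ ⟨g, rfl⟩
      let e : pow K V (M.image (g * ·)) ⟶ pow K V M :=
        powLift fun m => powProj V ⟨g * m, Finset.mem_image_of_mem _ m.2⟩
      convert isClosedCyl_preimage (e ≫ f) (isClosed_singleton_ev (d g)) using 1
      ext c
      rw [Set.mem_ofPred_eq, Set.mem_ofPred_eq, Set.mem_singleton_iff, ev_injective.eq_iff,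
        ← Category.assoc, comp_powLift]
      simp only [powLift_proj]
      rfl) (by
      intro t ht htf
      choose! γ hγ using ht
      obtain ⟨c, hc⟩ := h (htf.toFinset.image γ)
      refine ⟨c, fun s hs => ?_⟩
      rw [← hγ hs]
      exact hc _ (Finset.mem_image_of_mem γ (htf.mem_toFinset.mpr hs)))
  exact ⟨c, funext fun g => hc _ ⟨g, rfl⟩⟩

theorem exists_forall_img_ne_genericPoint [IsAlgClosed K] [IsProper V.hom]
    [IrreducibleSpace V.left] (f : pow K V M ⟶ V)
    (hf : ¬ Function.Surjective (caMap (T := Over.mk (𝟙 (SpecK K))) f)) :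
    ∃ Ω : Finset G, Ω.Nonempty ∧ ∀ (L : Type) [Field L] [Algebra K L]
      (c : G → (specOver K L ⟶ V)) (t : G),
      img (powLift fun ω : Ω => caMap f c (t * ω)) ≠ genericPoint (pow K V Ω).left := by
  classical
  obtain ⟨d, hd⟩ := not_forall.mp hf
  have hd' := mt (exists_caMap_eq f d) hd
  push Not at hd'
  obtain ⟨Ω₀, hΩ₀⟩ := hd'
  let Ω := insert 1 Ω₀
  have hΩ : ∀ c : G → Pt K V, ∃ g ∈ Ω, caMap f c g ≠ d g := fun c =>
    let ⟨g, hg, h⟩ := hΩ₀ c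
    ⟨g, Finset.mem_insert_of_mem hg, h⟩
  refine ⟨Ω, Finset.insert_nonempty _ _, fun L _ _ c t himg => ?_⟩
  obtain ⟨a, -⟩ := exists_ev_mem (W := V) Set.univ_nonempty isClosed_univ.isLocallyClosed
  let Λ : Finset G := Finset.image₂ (· * ·) Ω M
  let p := locMap a f Λ Ω
  have hp : IsProper p.left := isProper_left p
  have hmem : img (powLift fun ω : Ω => caMap f c (t * ω)) ∈ p.left '' Set.univ := by
    refine ⟨img (powLift fun l : Λ => c (t * l)), trivial, ?_⟩
    rw [← img_comp, powLift_comp_locMap]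
    congr 2
    funext ω
    simp only [caMap]
    congr 2
    funext m
    rw [extendPt_of_mem a _ (Finset.mem_image₂_of_mem ω.2 m.2), mul_assoc]
  rw [himg] at hmem
  have huniv := genericPoint_specializes (ev K (powLift fun ω : Ω => d ω))
  have hd := huniv.mem_closed (p.left.isClosedMap _ isClosed_univ) hmem
  obtain ⟨u, -, hu⟩ := exists_lift_ev p isClosed_univ.isLocallyClosed _ hd
  rw [← powLift_comp_powProj u, powLift_comp_locMap] at hu
  obtain ⟨g, hg, hne⟩ := hΩ (extendPt a fun i => u ≫ powProj V i)
  exact hne (by simpa using congrArg (fun w => w ≫ powProj V (⟨g, hg⟩ : Ω)) hu)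

end LocalMaps

section Counting

variable {G : Type} [Group G]

open Classical in
theorem Amenable.exists_card_image_mul_sdiff_lt (hG : Amenable G) (N : Finset G) (k : ℕ) :
    ∃ F : Finset G, k * (Finset.image₂ (· * ·) F N \ F).card < F.card := by
  obtain ⟨𝓕⟩ := hG
  have hlim := (tendsto_finsetSum N fun n _ => 𝓕.folner n).const_mul (k : ℝ)
  rw [Finset.sum_const_zero, mul_zero] at hlim
  obtain ⟨i, hi⟩ := (hlim.eventually_lt_const one_pos).exists
  refine ⟨𝓕.F i, ?_⟩
  set F := 𝓕.F i
  have hF : (0 : ℝ) < F.card := by exact_mod_cast (𝓕.nonempty i).card_pos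
  have hcard : ∀ n,
      ((F : Set G) \ ((· * n) '' (F : Set G))).ncard = (F.image (· * n) \ F).card := by
    intro n
    rw [← Finset.coe_image, ← Finset.coe_sdiff, Set.ncard_coe_finset]
    exact Finset.card_sdiff_comm (Finset.card_image_of_injective F (mul_left_injective n)).symm
  simp only [hcard] at hi
  rw [← Finset.sum_div, ← mul_div_assoc, div_lt_one hF] at hi
  have hle : (Finset.image₂ (· * ·) F N \ F).card ≤ ∑ n ∈ N, (F.image (· * n) \ F).card := by
    refine (Finset.card_le_card fun g hg => ?_).trans Finset.card_biUnion_le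
    obtain ⟨hg, hgF⟩ := Finset.mem_sdiff.mp hg
    obtain ⟨h, hh, n, hn, rfl⟩ := Finset.mem_image₂.mp hg
    exact Finset.mem_biUnion.mpr
      ⟨n, hn, Finset.mem_sdiff.mpr ⟨Finset.mem_image_of_mem (· * n) hh, hgF⟩⟩
  have hi' : k * ∑ n ∈ N, (F.image (· * n) \ F).card < F.card := by exact_mod_cast hi
  exact (Nat.mul_le_mul_left k hle).trans_lt hi'

theorem exists_disjoint_translates {Ω : Finset G} (hΩ : Ω.Nonempty) (F : Finset G) :
    ∃ T ⊆ F, (∀ t ∈ T, ∀ t' ∈ T, ∀ ω ∈ Ω, ∀ ω' ∈ Ω, t * ω = t' * ω' → t = t') ∧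
      F.card ≤ T.card * Ω.card ^ 2 := by
  classical
  let P : Finset G → Prop := fun T =>
    ∀ t ∈ T, ∀ t' ∈ T, ∀ ω ∈ Ω, ∀ ω' ∈ Ω, t * ω = t' * ω' → t = t'
  obtain ⟨T, hT, hmax⟩ := Finset.exists_max_image (F.powerset.filter P) Finset.card
    ⟨∅, by simp [P]⟩
  rw [Finset.mem_filter, Finset.mem_powerset] at hT
  refine ⟨T, hT.1, hT.2, ?_⟩
  have hcov : F ⊆ (T ×ˢ Ω ×ˢ Ω).image fun p => p.1 * p.2.1 * p.2.2⁻¹ := by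
    intro g hg
    by_contra hn
    have hgT : ∀ t ∈ T, ∀ ω ∈ Ω, ∀ ω' ∈ Ω, t * ω ≠ g * ω' := fun t ht ω hω ω' hω' h =>
      hn (Finset.mem_image.mpr ⟨(t, ω, ω'), by simp [ht, hω, hω'], by simp [h]⟩)
    have hg' : g ∉ T := fun h =>
      let ⟨ω, hω⟩ := hΩ
      hgT g h ω hω ω hω rfl
    have h := hmax (insert g T) (by
      refine Finset.mem_filter.mpr
        ⟨Finset.mem_powerset.mpr (Finset.insert_subset hg hT.1), ?_⟩
      intro t ht t' ht' ω hω ω' hω' h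
      rcases Finset.mem_insert.mp ht with rfl | htT <;>
        rcases Finset.mem_insert.mp ht' with rfl | htT'
      · rfl
      · exact (hgT t' htT' ω' hω' ω hω h.symm).elim
      · exact (hgT t htT ω hω ω' hω' h).elim
      · exact hT.2 t htT t' htT' ω hω ω' hω' h)
    rw [Finset.card_insert_of_notMem hg'] at h
    lia
  refine (Finset.card_le_card hcov).trans (Finset.card_image_le.trans_eq ?_)
  rw [Finset.card_product, Finset.card_product, sq]

variable {K : Type} [Field K] {V : Over (SpecK K)} {M : Finset G}

theorem exists_definedOver_of_img_ne [IsAlgClosed K] [IsProper V.hom] [IrreducibleSpace V.left]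
    {L : Type} [Field L] [Algebra K L] (y : G → (specOver K L ⟶ V)) {Ω S T : Finset G}
    (hy : ∀ t ∈ T, img (powLift fun ω : Ω => y (t * ω)) ≠ genericPoint (pow K V Ω).left)
    (hT : ∀ t ∈ T, ∀ t' ∈ T, ∀ ω ∈ Ω, ∀ ω' ∈ Ω, t * ω = t' * ω' → t = t')
    (hTS : ∀ t ∈ T, ∀ ω ∈ Ω, t * ω ∈ S) :
    ∃ s : Finset L, s.card + T.card ≤ S.card * gdim V ∧
      ∀ g ∈ S, DefinedOver (acl K (s : Set L)) (y g) := by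
  classical
  let TΩ : Finset G := Finset.image₂ (· * ·) T Ω
  have hTΩ : TΩ.card = T.card * Ω.card := by
    refine Finset.card_image₂_iff.mpr ?_
    rintro ⟨t, ω⟩ ⟨ht, hω⟩ ⟨t', ω'⟩ ⟨ht', hω'⟩ h
    obtain rfl := hT t ht t' ht' ω hω ω' hω' h
    simpa using h
  have hTΩS : TΩ ⊆ S := Finset.image₂_subset_iff.mpr hTS
  have htile : ∀ t ∈ T, ∃ s : Finset L, s.card + 1 ≤ gdim (pow K V Ω) ∧
      DefinedOver (acl K (s : Set L)) (powLift fun ω : Ω => y (t * ω)) :=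
    fun t ht => exists_definedOver_acl_of_ne _ (hy t ht)
  obtain ⟨s₁, hs₁, h₁⟩ := exists_forall_definedOver T
    (fun t => powLift fun ω : Ω => y (t * ω)) (fun _ => gdim (pow K V Ω) - 1) fun t ht =>
      let ⟨s, hs, h⟩ := htile t ht
      ⟨s, by lia, h⟩
  obtain ⟨s₂, hs₂, h₂⟩ := exists_forall_definedOver (S \ TΩ) y (fun _ => gdim V) fun g _ =>
    exists_definedOver_acl (y g)
  rw [Finset.sum_const, smul_eq_mul] at hs₁ hs₂
  refine ⟨s₁ ∪ s₂, ?_, fun g hg => ?_⟩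
  · have hpow := gdim_pow_le V Ω
    rw [Nat.card_eq_fintype_card, Fintype.card_coe] at hpow
    have h₁' : s₁.card + T.card ≤ T.card * gdim (pow K V Ω) := by
      rcases T.eq_empty_or_nonempty with rfl | ⟨t, ht⟩
      · simpa using hs₁
      · obtain ⟨s, hs, -⟩ := htile t ht
        obtain ⟨n, hn⟩ : ∃ n, gdim (pow K V Ω) = n + 1 := ⟨gdim (pow K V Ω) - 1, by lia⟩
        rw [hn] at hs₁ ⊢
        rw [mul_add_one]
        simpa using hs₁
    have hS : S.card = (S \ TΩ).card + T.card * Ω.card := by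
      rw [← hTΩ, Finset.card_sdiff_add_card_eq_card hTΩS]
    calc (s₁ ∪ s₂).card + T.card ≤ (s₁.card + T.card) + s₂.card := by
          have := Finset.card_union_le s₁ s₂
          lia
      _ ≤ T.card * (Ω.card * gdim V) + (S \ TΩ).card * gdim V :=
          add_le_add (h₁'.trans (Nat.mul_le_mul_left _ hpow)) hs₂
      _ = S.card * gdim V := by rw [hS]; ring
  · by_cases hgT : g ∈ TΩ
    · obtain ⟨t, ht, ω, hω, rfl⟩ := Finset.mem_image₂.mp hgT
      have h := ((h₁ t ht).comp (powProj V ⟨ω, hω⟩)).mono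
        (acl_mono (t := (↑(s₁ ∪ s₂) : Set L)) (by simp))
      rwa [powLift_proj] at h
    · exact (h₂ g (Finset.mem_sdiff.mpr ⟨hg, hgT⟩)).mono (acl_mono (by simp))

theorem surjective_caMap_of_preInjective [IsAlgClosed K] [IsProper V.hom]
    [IrreducibleSpace V.left] (hG : Amenable G) (f : pow K V M ⟶ V)
    (hpre : PreInjective K V (caMap f)) :
    Function.Surjective (caMap (T := Over.mk (𝟙 (SpecK K))) f) := by
  classical
  by_contra hf
  obtain ⟨Ω, hΩ, hgen⟩ := exists_forall_img_ne_genericPoint f hf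
  obtain ⟨a, -⟩ := exists_ev_mem (W := V) Set.univ_nonempty isClosed_univ.isLocallyClosed
  let N : Finset G := insert 1 (M.image (·⁻¹) ∪ Ω)
  obtain ⟨F, hF⟩ := hG.exists_card_image_mul_sdiff_lt N (gdim V * Ω.card ^ 2)
  let S : Finset G := Finset.image₂ (· * ·) F N
  have hFS : F ⊆ S := fun g hg =>
    Finset.mem_image₂.mpr ⟨g, hg, 1, Finset.mem_insert_self _ _, mul_one g⟩
  have hMS : ∀ g ∈ F, ∀ m ∈ M, g * m⁻¹ ∈ S := fun g hg m hm =>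
    Finset.mem_image₂_of_mem hg (Finset.mem_insert_of_mem
      (Finset.mem_union_left _ (Finset.mem_image_of_mem _ hm)))
  have hΩS : ∀ g ∈ F, ∀ ω ∈ Ω, g * ω ∈ S := fun g hg ω hω =>
    Finset.mem_image₂_of_mem hg (Finset.mem_insert_of_mem (Finset.mem_union_right _ hω))
  obtain ⟨T, hTF, hT, hFT⟩ := exists_disjoint_translates hΩ F
  obtain ⟨L, _, _, _, x, hx⟩ := exists_generic_family V F
  obtain ⟨s, hs, hys⟩ := exists_definedOver_of_img_ne (caMap f (extendPt a x))
    (fun t _ => hgen L _ t) hT fun t ht => hΩS t (hTF ht)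
  have hdef : DefinedOver (acl K (s : Set L)) (powLift x) := by
    refine DefinedOver.of_comp (locMap a f F S) (locMap_injective a f hpre hMS) ?_
    rw [powLift_comp_locMap]
    exact DefinedOver.pow fun g => hys g g.2
  have hle := hx s fun i => by simpa using hdef.comp (powProj V i)
  rw [Nat.card_eq_fintype_card, Fintype.card_coe] at hle
  have hS : S.card = (S \ F).card + F.card := (Finset.card_sdiff_add_card_eq_card hFS).symm
  have hTle : T.card ≤ (S \ F).card * gdim V := by
    rw [hS, add_mul] at hs
    lia
  have := calc F.card ≤ T.card * Ω.card ^ 2 := hFT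
    _ ≤ (S \ F).card * gdim V * Ω.card ^ 2 := Nat.mul_le_mul_right _ hTle
    _ = gdim V * Ω.card ^ 2 * (S \ F).card := by ring
  exact absurd hF this.not_gt

end Counting

/-- Theorem 1.1, Myhill direction of the Garden of Eden theorem.
Let `G` be an amenable group and `X` an irreducible complete algebraic variety over an
algebraically closed field `K`, with `A := X(K)`. Then every pre-injective algebraic
cellular automaton `τ : A^G → A^G` over `(G,X,K)` is surjective. -/
theorem preInjective_implies_surjective
    (G : Type) [Group G] (hG : Amenable G)
    (K : Type) [Field K] [IsAlgClosed K]
    (V : Over (SpecK K)) (hft : LocallyOfFiniteType V.hom) (hqc : QuasiCompact V.hom)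
    (hirr : IrreducibleSpace V.left) (hcomplete : IsProper V.hom)
    (τ : (G → Pt K V) → (G → Pt K V)) (hca : IsAlgCA K V τ)
    (hpre : PreInjective K V τ) :
    Function.Surjective τ := by
  obtain ⟨M, f, hf⟩ := hca
  have hτ : τ = caMap f := funext fun c => funext fun g => hf c g
  subst hτ
  exact surjective_caMap_of_preInjective hG f hpre

end GOE
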